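/- For every f ∈ F, setting c = 1/(2k−1)^(2|f|), the following holds: whenever E, S ⊆ ∂F are disjoint Borel sets satisfying f·(∂F ∖ E) ⊆ S and f⁻¹·(∂F ∖ S) ⊆ E, one has η_A((E × S) ∩ ∂²F) ≥ c·(1 − μ_A(E))·(1 − μ_A(S)). In particular, under these hypotheses η_A((E × S) ∩ ∂²F) = 0 if and only if μ_A(E) = 1 or μ_A(S) = 1. -/

import Mathlib

open MeasureTheory Filter Topology
open scoped ENNReal NNReal

namespace FGC

noncomputable section

variable (k : ℕ)

/-- The alphabet `A = Σ ∪ Σ⁻¹`: a letter is a basis element together with a sign. -/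
abbrev L := Fin k × Bool

/-- The inverse of a letter. -/
def linv (a : L k) : L k := (a.1, !a.2)

/-- A right-infinite word is (freely) reduced if no letter is followed by its inverse. -/
def Red (x : ℕ → L k) : Prop := ∀ n, x (n + 1) ≠ linv k (x n)

/-- The boundary `∂F`: the set of infinite freely reduced words in the alphabet `A`. -/
def Boundary : Type := { x : ℕ → L k // Red k x }

instance : TopologicalSpace (Boundary k) :=
  inferInstanceAs (TopologicalSpace { x : ℕ → L k // Red k x })

instance : MeasurableSpace (Boundary k) := borel _

instance : BorelSpace (Boundary k) := ⟨rfl⟩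

/-- The free group of rank `k`. -/
abbrev F := FreeGroup (Fin k)

/-- The word length `|v|` of an element of `F`. -/
def wordLength (v : F k) : ℕ := v.toWord.length

/-- The cyclically reduced length `‖v‖`: the minimal word length among conjugates of `v`. -/
def cyclLength (v : F k) : ℕ := sInf { n | ∃ g : F k, wordLength k (g * v * g⁻¹) = n }

/-- The cylinder `Cyl v ⊆ ∂F` of rays starting with the reduced word of `v`. -/
def Cyl (v : F k) : Set (Boundary k) :=
  { x | ∀ i : Fin v.toWord.length, x.1 i = v.toWord.get i }

/-- The shift deleting the first letter of a ray. -/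
def shift (x : ℕ → L k) : ℕ → L k := fun n => x (n + 1)

/-- Prepending a letter to a ray. -/
def cons (a : L k) (x : ℕ → L k) : ℕ → L k
  | 0 => a
  | n + 1 => x n

/-- Prepending a (reversed) finite word to a ray, performing free reduction. -/
def prependAux : List (L k) → (ℕ → L k) → ℕ → L k
  | [], x => x
  | a :: r, x => prependAux r (if x 0 = linv k a then shift k x else cons k a x)

theorem red_shift {x : ℕ → L k} (hx : Red k x) : Red k (shift k x) :=
  fun n => hx (n + 1)

theorem red_cons {a : L k} {x : ℕ → L k} (hx : Red k x) (h : x 0 ≠ linv k a) :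
    Red k (cons k a x) := by
  intro n
  cases n with
  | zero => exact h
  | succ m => exact hx m

theorem red_prependAux : ∀ (r : List (L k)) {x : ℕ → L k}, Red k x → Red k (prependAux k r x)
  | [], _, hx => hx
  | a :: r, x, hx => by
    by_cases h : x 0 = linv k a
    · simp only [prependAux, if_pos h]
      exact red_prependAux r (red_shift k hx)
    · simp only [prependAux, if_neg h]
      exact red_prependAux r (red_cons k hx h)

/-- The left-translation action of `F` on `∂F`: concatenate and freely reduce. -/
def act (g : F k) (x : Boundary k) : Boundary k :=
  ⟨prependAux k g.toWord.reverse x.1, red_prependAux k _ x.2⟩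

/-- The shift map `T : ∂F → ∂F`. -/
def Tmap (x : Boundary k) : Boundary k := ⟨shift k x.1, red_shift k x.2⟩

/-- The double boundary `∂²F`, as the complement of the diagonal. -/
def D2 : Set (Boundary k × Boundary k) := { p | p.1 ≠ p.2 }

/-- The diagonal action of `F` on `∂F × ∂F`. -/
def actPair (g : F k) (p : Boundary k × Boundary k) : Boundary k × Boundary k :=
  (act k g p.1, act k g p.2)

/-- The cylinder `Cyl[1,w]` of geodesics through the segment from `1` to `w`. -/
def baseCyl (w : F k) : Set (Boundary k × Boundary k) :=
  { p | p.1.1 0 ≠ p.2.1 0 ∧ p.2 ∈ Cyl k w }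

/-- The base-ball `B = Cyl[1,1]` of geodesics through the base point. -/
def baseBall : Set (Boundary k × Boundary k) := baseCyl k 1

/-- The cylinder `Cyl[x,y] = x · Cyl[1, x⁻¹y]`. -/
def Cyl2 (x y : F k) : Set (Boundary k × Boundary k) :=
  actPair k x '' baseCyl k (x⁻¹ * y)

/-- A geodesic current: a Borel measure on `∂F × ∂F` giving no mass to the diagonal,
invariant under the diagonal `F`-action, and finite on compact subsets of `∂²F`. -/
def IsCurrent (η : Measure (Boundary k × Boundary k)) : Prop :=
  η { p | p.1 = p.2 } = 0 ∧
  (∀ g : F k, ∀ W : Set (Boundary k × Boundary k), MeasurableSet W →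
    η (actPair k g ⁻¹' W) = η W) ∧
  (∀ K : Set (Boundary k × Boundary k), K ⊆ D2 k → IsCompact K → η K < ⊤)

/-- The element of `F` given by the first `n` letters of a ray. -/
def prefixEl (x : Boundary k) (n : ℕ) : F k :=
  FreeGroup.mk (List.ofFn fun i : Fin n => x.1 i)

/-- `b : ∂F → ∂F` is the boundary extension of the automorphism `Φ`: for every ray `x`
and every `m`, the length-`m` prefix of `b x` is the length-`m` prefix of the reduced
word of `Φ (x|_n)` for all sufficiently large `n`. -/
def IsBdryExt (Φ : F k ≃* F k) (b : Boundary k → Boundary k) : Prop :=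
  ∀ x : Boundary k, ∀ m : ℕ, ∃ N : ℕ, ∀ n ≥ N,
    (Φ (prefixEl k x n)).toWord.take m = List.ofFn fun i : Fin m => (b x).1 i

/-- The map `∂Φ × ∂Φ` on pairs. -/
def pairMap (b : Boundary k → Boundary k) (p : Boundary k × Boundary k) :
    Boundary k × Boundary k := (b p.1, b p.2)

/-- The length of an automorphism with boundary map `b`, w.r.t. the current `η`:
`L(Φ) = η((∂Φ × ∂Φ)⁻¹ B)`. -/
def autLen (η : Measure (Boundary k × Boundary k)) (b : Boundary k → Boundary k) : ℝ≥0∞ :=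
  η (pairMap k b ⁻¹' baseBall k)

/-- The subgroup of inner automorphisms. -/
abbrev Inn : Subgroup (MulAut (F k)) := (MulAut.conj : F k →* MulAut (F k)).range

/-- `Out(F) = Aut(F)/Inn(F)` as a coset space. -/
abbrev OutQ := MulAut (F k) ⧸ Inn k

/-- A simple automorphism: induced by a permutation of the basis, or inner. -/
def SimpleAut (Φ : MulAut (F k)) : Prop :=
  (∃ σ : Equiv.Perm (Fin k), ∀ i, Φ (FreeGroup.of i) = FreeGroup.of (σ i)) ∨
  (∃ v : F k, ∀ x, Φ x = v * x * v⁻¹)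

/-- A Whitehead automorphism of the second kind. -/
def Whitehead2 (τ : MulAut (F k)) : Prop :=
  ∃ a : Fin k, ∀ i : Fin k,
    τ (FreeGroup.of i) = FreeGroup.of i ∨
    τ (FreeGroup.of i) = FreeGroup.of i * FreeGroup.of a ∨
    τ (FreeGroup.of i) = (FreeGroup.of a)⁻¹ * FreeGroup.of i ∨
    τ (FreeGroup.of i) = (FreeGroup.of a)⁻¹ * FreeGroup.of i * FreeGroup.of a

/-- The space of frequency measures: finite `T`-invariant Borel measures on `∂F`. -/
def FreqM : Type :=
  { μ : Measure (Boundary k) //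
    IsFiniteMeasure μ ∧ ∀ W : Set (Boundary k), MeasurableSet W → μ (Tmap k ⁻¹' W) = μ W }

/-- The space of geodesic currents. -/
def Currents : Type := { η : Measure (Boundary k × Boundary k) // IsCurrent k η }

/-- Continuous functions on `∂F × ∂F` with compact support contained in `∂²F`;
these are the test functions for the weak-* topology on currents. -/
def TestF : Type :=
  { φ : Boundary k × Boundary k → ℝ //
    Continuous φ ∧ IsCompact (tsupport φ) ∧ tsupport φ ⊆ D2 k }

/-- The weak-* topology on frequency measures. -/
instance : TopologicalSpace (FreqM k) :=
  ⨅ φ : C(Boundary k, ℝ),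
    TopologicalSpace.induced (fun μ : FreqM k => ∫ x, φ x ∂μ.1) inferInstance

/-- The weak-* topology on geodesic currents. -/
instance : TopologicalSpace (Currents k) :=
  ⨅ φ : TestF k,
    TopologicalSpace.induced (fun η : Currents k => ∫ p, φ.1 p ∂η.1) inferInstance

/-- Convergence of a sequence of group elements (as reduced words) to a boundary ray. -/
def WordTendsto (pn : ℕ → F k) (p : Boundary k) : Prop :=
  ∀ m : ℕ, ∃ N : ℕ, ∀ n ≥ N, (pn n).toWord.take m = List.ofFn fun i : Fin m => p.1 i

/-- The length of the maximal common initial segment of two rays. -/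
def commonLen (p : Boundary k × Boundary k) : ℕ :=
  sSup { m : ℕ | ∀ i < m, p.1.1 i = p.2.1 i }

/-- A single letter as an element of `F`. -/
def el (a : L k) : F k := FreeGroup.mk [a]

/-- The product of per-letter constants over the reduced word of `w`. -/
def Cprod (C : L k → ℝ≥0) (w : F k) : ℝ≥0 := (w.toWord.map C).prod

/-! ### Comparing measures on fibres of a refining sequence of partitions -/

theorem measure_le_of_fibers {X α : Type*} [TopologicalSpace X] [MeasurableSpace X] [BorelSpace X]
    [Countable α] (π : ℕ → X → α) (hmeas : ∀ m a, MeasurableSet (π m ⁻¹' {a}))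
    (hanti : ∀ m n x y, m ≤ n → π n x = π n y → π m x = π m y)
    (hbasis : ∀ U, IsOpen U → ∀ x ∈ U, ∃ m, ∀ y, π m y = π m x → y ∈ U)
    (μ ν : Measure X) [ν.OuterRegular]
    (h : ∀ m x, μ (π m ⁻¹' {π m x}) ≤ ν (π m ⁻¹' {π m x})) : μ ≤ ν := by
  have hfib : ∀ m a, μ (π m ⁻¹' {a}) ≤ ν (π m ⁻¹' {a}) := by
    intro m a
    by_cases ha : ∃ x, π m x = a
    · obtain ⟨x, rfl⟩ := ha
      exact h m x
    · have : π m ⁻¹' {a} = ∅ := by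
        ext x
        simpa using fun hx => ha ⟨x, hx⟩
      simp [this]
  have hpre : ∀ m (A : Set α), μ (π m ⁻¹' A) ≤ ν (π m ⁻¹' A) := by
    intro m A
    rw [← tsum_measure_preimage_singleton A.to_countable (fun a _ => hmeas m a),
      ← tsum_measure_preimage_singleton A.to_countable (fun a _ => hmeas m a)]
    exact ENNReal.tsum_le_tsum fun a => hfib m a
  have hopen : ∀ U, IsOpen U → μ U ≤ ν U := by
    intro U hU
    set V : ℕ → Set X := fun m => π m ⁻¹' {a | π m ⁻¹' {a} ⊆ U} with hV
    have hVU : ∀ m, V m ⊆ U := fun m x hx => hx rfl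
    have hmono : Monotone V := by
      intro m n hmn x hx y hy
      exact hx (hanti m n y x hmn hy)
    have hUV : U = ⋃ m, V m := by
      refine Set.Subset.antisymm (fun x hx => ?_) (Set.iUnion_subset hVU)
      obtain ⟨m, hm⟩ := hbasis U hU x hx
      exact Set.mem_iUnion.2 ⟨m, fun y hy => hm y hy⟩
    calc μ U = μ (⋃ m, V m) := by rw [← hUV]
      _ = ⨆ m, μ (V m) := hmono.measure_iUnion
      _ ≤ ν U := iSup_le fun m => (hpre m _).trans (measure_mono (hVU m))
  refine Measure.le_iff.2 fun W _ => ?_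
  rw [W.measure_eq_iInf_isOpen ν]
  exact le_iInf₂ fun U hWU => le_iInf fun hU => (measure_mono hWU).trans (hopen U hU)

/-! ### Finite prefixes of rays -/

section Prefixes

variable {k}

theorem linv_linv (a : L k) : linv k (linv k a) = a := by simp [linv]

theorem cons_shift (x : ℕ → L k) : cons k (x 0) (shift k x) = x := by
  funext n
  cases n <;> rfl

theorem shift_cons (a : L k) (x : ℕ → L k) : shift k (cons k a x) = x := rfl

theorem red_cons_iff {a : L k} {x : ℕ → L k} :
    Red k (cons k a x) ↔ Red k x ∧ x 0 ≠ linv k a :=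
  ⟨fun h => ⟨red_shift k h, h 0⟩, fun h => red_cons k h.1 h.2⟩

/-- Concatenation of a finite word and a ray, without reduction. -/
def app : List (L k) → (ℕ → L k) → ℕ → L k
  | [], x => x
  | a :: l, x => cons k a (app l x)

/-- The word formed by the first `m` letters of a ray. -/
def pre : ℕ → (ℕ → L k) → List (L k)
  | 0, _ => []
  | m + 1, x => x 0 :: pre m (shift k x)

theorem app_append (l l' : List (L k)) (x : ℕ → L k) : app (l ++ l') x = app l (app l' x) := by
  induction l with
  | nil => rfl
  | cons a l ih => simp [app, ih]

theorem length_pre (m : ℕ) (x : ℕ → L k) : (pre m x).length = m := by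
  induction m generalizing x with
  | zero => rfl
  | succ m ih => simp [pre, ih]

theorem pre_app (l : List (L k)) (x : ℕ → L k) : pre l.length (app l x) = l := by
  induction l with
  | nil => rfl
  | cons a l ih => simp [pre, app, shift_cons, ih, cons]

theorem exists_app_pre (m : ℕ) {x : ℕ → L k} (hx : Red k x) :
    ∃ y, Red k y ∧ x = app (pre m x) y ∧ y 0 = x m := by
  induction m generalizing x with
  | zero => exact ⟨x, hx, rfl, rfl⟩
  | succ m ih =>
    obtain ⟨y, hy, h, h0⟩ := ih (red_shift k hx)
    refine ⟨y, hy, ?_, h0⟩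
    rw [pre, app, ← h, cons_shift]

theorem pre_eq_iff {m : ℕ} {x y : ℕ → L k} : pre m x = pre m y ↔ ∀ i < m, x i = y i := by
  induction m generalizing x y with
  | zero => simp [pre]
  | succ m ih =>
    simp only [pre, List.cons.injEq, ih]
    constructor
    · rintro ⟨h0, h⟩ i hi
      cases i with
      | zero => exact h0
      | succ i => exact h i (by omega)
    · intro h
      exact ⟨h 0 (by omega), fun i hi => h (i + 1) (by omega)⟩

theorem mem_Cyl_iff {v : F k} {x : Boundary k} :
    x ∈ Cyl k v ↔ pre v.toWord.length x.1 = v.toWord := by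
  have key : ∀ (l : List (L k)) (x : ℕ → L k),
      (∀ i : Fin l.length, x i = l.get i) ↔ pre l.length x = l := by
    intro l
    induction l with
    | nil => simp [pre]
    | cons a l ih =>
      intro x
      simp only [List.length_cons, pre, List.cons.injEq, ← ih]
      rw [Fin.forall_fin_succ]
      rfl
  exact key _ _

theorem red_of_red_app {l : List (L k)} {x : ℕ → L k} (h : Red k (app l x)) : Red k x := by
  induction l with
  | nil => exact h
  | cons a l ih => exact ih (red_shift k h)

theorem isReduced_of_red_app {l : List (L k)} {x : ℕ → L k} (h : Red k (app l x)) :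
    FreeGroup.IsReduced l := by
  induction l with
  | nil => exact FreeGroup.IsReduced.nil
  | cons a l ih =>
    cases l with
    | nil => exact FreeGroup.IsReduced.singleton
    | cons b l =>
      refine FreeGroup.isReduced_cons_cons.2 ⟨fun h1 => ?_, ih (red_shift k h)⟩
      have h0 : b ≠ linv k a := h 0
      by_contra h2
      refine h0 (Prod.ext h1.symm ?_)
      simp only [linv]
      cases hb : b.2 <;> cases ha : a.2 <;> simp_all

theorem toWord_mk_of_red_app {l : List (L k)} {x : ℕ → L k} (h : Red k (app l x)) :
    (FreeGroup.mk l).toWord = l := by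
  rw [FreeGroup.toWord_mk, (isReduced_of_red_app h).reduce_eq]

theorem app_zero_congr (l : List (L k)) {x y : ℕ → L k} (h : x 0 = y 0) :
    app l x 0 = app l y 0 := by
  cases l with
  | nil => exact h
  | cons a l => rfl

theorem red_app_congr {l : List (L k)} {x y : ℕ → L k} (h : Red k (app l x)) (hy : Red k y)
    (h0 : x 0 = y 0) : Red k (app l y) := by
  induction l with
  | nil => exact hy
  | cons a l ih =>
    have h' := red_cons_iff.1 h
    exact red_cons k (ih h'.1) (app_zero_congr l h0 ▸ h'.2)

theorem invRev_cons (a : L k) (l : List (L k)) :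
    FreeGroup.invRev (a :: l) = FreeGroup.invRev l ++ [linv k a] := by
  simp [FreeGroup.invRev, linv]

/-- The inverse of the word `l` may precede `z` if `z` branches off from `l`. -/
theorem red_app_invRev {l : List (L k)} {s z : ℕ → L k} (h : Red k (app l s)) (hz : Red k z)
    (h0 : z 0 ≠ app l s 0) :
    Red k (app (FreeGroup.invRev l) z) ∧ s 0 ≠ app (FreeGroup.invRev l) z 0 := by
  induction l generalizing z with
  | nil => exact ⟨hz, h0.symm⟩
  | cons a l ih =>
    have h' := red_cons_iff.1 h
    have hz' : Red k (cons k (linv k a) z) := red_cons k hz (by rw [linv_linv]; exact h0)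
    rw [invRev_cons, app_append]
    exact ih h'.1 hz' h'.2.symm

/-! ### Left multiplication by a word -/

theorem prependAux_append (l l' : List (L k)) (x : ℕ → L k) :
    prependAux k (l ++ l') x = prependAux k l' (prependAux k l x) := by
  induction l generalizing x with
  | nil => rfl
  | cons a l ih => simp only [List.cons_append, prependAux, ih]

theorem prependAux_reverse_of_red (l : List (L k)) {x : ℕ → L k} (h : Red k (app l x)) :
    prependAux k l.reverse x = app l x := by
  induction l using List.reverseRecOn generalizing x with
  | nil => rfl
  | append_singleton l a ih =>
    rw [app_append] at h ⊢
    have h0 : x 0 ≠ linv k a := (red_cons_iff.1 (red_of_red_app h)).2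
    rw [List.reverse_append, List.reverse_singleton, List.singleton_append, prependAux, if_neg h0]
    exact ih h

theorem prependAux_map_linv (l : List (L k)) (x : ℕ → L k) :
    prependAux k l (app (l.map (linv k)) x) = x := by
  induction l with
  | nil => rfl
  | cons a l ih =>
    rw [List.map_cons, app, prependAux, if_pos (show cons k (linv k a) _ 0 = linv k a from rfl),
      shift_cons, ih]

theorem prependAux_reverse_invRev (l : List (L k)) (x : ℕ → L k) :
    prependAux k l.reverse (app (FreeGroup.invRev l) x) = x := by
  have : FreeGroup.invRev l = l.reverse.map (linv k) := by
    rw [FreeGroup.invRev, List.map_reverse]; rfl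
  rw [this, prependAux_map_linv]

/-- Every cylinder of depth `m` contains the translate of a cylinder of depth at most
`m + |r|`. -/
theorem exists_cylinder_prependAux (r : List (L k)) {m : ℕ} (hm : 1 ≤ m) {x : ℕ → L k}
    (hx : Red k x) :
    ∃ x', Red k x' ∧ ∃ m', 1 ≤ m' ∧ m' ≤ m + r.length ∧
      ∀ y, Red k y → (∀ i < m', y i = x' i) → ∀ i < m, prependAux k r y i = x i := by
  induction r with
  | nil => exact ⟨x, hx, m, hm, le_rfl, fun y _ h => h⟩
  | cons a r ih =>
    obtain ⟨x', hx', m', hm', hle, H⟩ := ih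
    by_cases h0 : x' 0 = a
    · refine ⟨shift k x', red_shift k hx', m', hm', by simp; omega, fun y hy h => ?_⟩
      have hy0 : y 0 ≠ linv k a := by
        rw [h 0 hm', ← h0]
        exact hx' 0
      rw [prependAux, if_neg hy0]
      refine H _ (red_cons k hy hy0) fun i hi => ?_
      cases i with
      | zero => exact h0.symm
      | succ i => exact h i (by omega)
    · refine ⟨cons k (linv k a) x', red_cons k hx' (by rwa [linv_linv]), m' + 1, by omega,
        by simp; omega, fun y hy h => ?_⟩
      rw [prependAux, if_pos (show y 0 = linv k a from h 0 (by omega))]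
      exact H _ (red_shift k hy) fun i hi => h (i + 1) (by omega)

theorem continuous_prependAux (r : List (L k)) : Continuous (prependAux k r) := by
  induction r with
  | nil => exact continuous_id
  | cons a r ih =>
    refine ih.comp (continuous_pi fun n => ?_)
    have : (fun x : ℕ → L k => (if x 0 = linv k a then shift k x else cons k a x) n) =
        (fun t : L k × L k × L k => if t.1 = linv k a then t.2.1 else
          if n = 0 then a else t.2.2) ∘ fun x : ℕ → L k => (x 0, x (n + 1), x (n - 1)) := by
      funext x
      simp only [Function.comp]
      split_ifs with h1 h2
      · rfl
      · subst h2; rfl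
      · obtain ⟨n, rfl⟩ := Nat.exists_eq_succ_of_ne_zero h2; rfl
    rw [this]
    exact continuous_of_discreteTopology.comp (by fun_prop)

end Prefixes

/-! ### Topology of the boundary -/

section Topology

variable {k}

instance : SecondCountableTopology (Boundary k) := by
  have : SecondCountableTopology (L k) := DiscreteTopology.secondCountableTopology_of_countable
  have : SecondCountableTopology (ℕ → L k) := inferInstance
  exact TopologicalSpace.Subtype.secondCountableTopology _

instance : T2Space (Boundary k) :=
  inferInstanceAs (T2Space { x : ℕ → L k // Red k x })

instance : CompactSpace (Boundary k) := by
  refine isCompact_iff_compactSpace.1 (IsClosed.isCompact ?_)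
  have : {x : ℕ → L k | Red k x} = ⋂ n, {x | x (n + 1) ≠ linv k (x n)} := by
    ext x
    simp [Red]
  change IsClosed {x : ℕ → L k | Red k x}
  rw [this]
  refine isClosed_iInter fun n => ?_
  exact (isClosed_discrete {t : L k × L k | t.1 ≠ linv k t.2}).preimage
    (f := fun x : ℕ → L k => (x (n + 1), x n)) (by fun_prop)

theorem continuous_letter (n : ℕ) : Continuous fun x : Boundary k => x.1 n :=
  (continuous_apply n).comp continuous_subtype_val

theorem continuous_act (g : F k) : Continuous (act k g) :=
  Continuous.subtype_mk ((continuous_prependAux _).comp continuous_subtype_val) _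

theorem exists_pre_eq_comp (m : ℕ) : ∃ g : (Fin m → L k) → List (L k),
    ∀ x : ℕ → L k, pre m x = g fun i => x i := by
  induction m with
  | zero => exact ⟨fun _ => [], fun _ => rfl⟩
  | succ m ih =>
    obtain ⟨g, hg⟩ := ih
    exact ⟨fun t => t 0 :: g fun i => t i.succ, fun x => by rw [pre, hg]; rfl⟩

theorem isClopen_pre (m : ℕ) (l : List (L k)) : IsClopen {x : Boundary k | pre m x.1 = l} := by
  obtain ⟨g, hg⟩ := exists_pre_eq_comp (k := k) m
  have : {x : Boundary k | pre m x.1 = l} =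
      (fun x : Boundary k => fun i : Fin m => x.1 i) ⁻¹' {t | g t = l} := by
    ext x
    simp [hg]
  rw [this]
  exact (isClopen_discrete _).preimage (continuous_pi fun i => continuous_letter _)

theorem exists_pre_subset {U : Set (Boundary k)} (hU : IsOpen U) {x : Boundary k} (hx : x ∈ U) :
    ∃ m, ∀ n, m ≤ n → ∀ y : Boundary k, pre n y.1 = pre n x.1 → y ∈ U := by
  obtain ⟨O, hO, rfl⟩ := isOpen_induced_iff.1 hU
  obtain ⟨I, u, hu, hIu⟩ := isOpen_pi_iff.1 hO x.1 hx
  refine ⟨I.sup id + 1, fun n hn y hy => hIu fun i hi => ?_⟩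
  have : i ≤ I.sup id := Finset.le_sup (f := id) hi
  rw [pre_eq_iff.1 hy i (by omega)]
  exact (hu i hi).2

theorem pre_eq_of_le {m n : ℕ} {x y : ℕ → L k} (hmn : m ≤ n) (h : pre n x = pre n y) :
    pre m x = pre m y :=
  pre_eq_iff.2 fun i hi => pre_eq_iff.1 h i (hi.trans_le hmn)

/-- Comparison of measures on the boundary through cylinders of positive depth. -/
theorem measure_le_of_pre (μ ν : Measure (Boundary k)) [IsFiniteMeasure ν]
    (h : ∀ m (x : Boundary k), 1 ≤ m →
      μ {y | pre m y.1 = pre m x.1} ≤ ν {y | pre m y.1 = pre m x.1}) : μ ≤ ν := by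
  refine measure_le_of_fibers (fun m (x : Boundary k) => pre (m + 1) x.1)
    (fun m a => (isClopen_pre (m + 1) a).isOpen.measurableSet)
    (fun m n x y hmn hxy => pre_eq_of_le (by omega) hxy) (fun U hU x hx => ?_) μ ν
    (fun m x => h (m + 1) x (by omega))
  obtain ⟨m, hm⟩ := exists_pre_subset hU hx
  exact ⟨m, hm (m + 1) (by omega)⟩

/-- Comparison of measures on pairs of rays through products of deep cylinders. -/
theorem measure_le_of_pre_prod (N : ℕ) (μ ν : Measure (Boundary k × Boundary k))
    [IsFiniteMeasure ν]
    (h : ∀ m (p : Boundary k × Boundary k), N ≤ m →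
      μ ({y | pre m y.1 = pre m p.1.1} ×ˢ {y | pre m y.1 = pre m p.2.1}) ≤
      ν ({y | pre m y.1 = pre m p.1.1} ×ˢ {y | pre m y.1 = pre m p.2.1})) : μ ≤ ν := by
  have hset : ∀ m (a : List (L k) × List (L k)),
      (fun p : Boundary k × Boundary k => (pre (m + N) p.1.1, pre (m + N) p.2.1)) ⁻¹' {a} =
      {y | pre (m + N) y.1 = a.1} ×ˢ {y | pre (m + N) y.1 = a.2} := by
    rintro m ⟨a, b⟩
    ext p
    simp
  refine measure_le_of_fibers
    (fun m (p : Boundary k × Boundary k) => (pre (m + N) p.1.1, pre (m + N) p.2.1))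
    (fun m a => ?_) (fun m n p q hmn hpq => ?_) (fun U hU p hp => ?_) μ ν (fun m p => ?_)
  · rw [hset]
    exact (isClopen_pre _ _).isOpen.measurableSet.prod (isClopen_pre _ _).isOpen.measurableSet
  · simp only [Prod.mk.injEq] at hpq ⊢
    exact ⟨pre_eq_of_le (by omega) hpq.1, pre_eq_of_le (by omega) hpq.2⟩
  · obtain ⟨u, v, hu, hv, hpu, hpv, huv⟩ := isOpen_prod_iff.1 hU p.1 p.2 hp
    obtain ⟨m, hm⟩ := exists_pre_subset hu hpu
    obtain ⟨n, hn⟩ := exists_pre_subset hv hpv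
    refine ⟨m + n, fun q hq => huv ?_⟩
    simp only [Prod.mk.injEq] at hq
    exact ⟨hm _ (by omega) _ hq.1, hn _ (by omega) _ hq.2⟩
  · rw [hset]
    exact h (m + N) p (by omega)

end Topology

/-! ### Cylinders of pairs of rays -/

section Cylinders

variable {k}

theorem pre_add (n j : ℕ) (x : ℕ → L k) :
    pre (n + j) x = pre n x ++ pre j (fun i => x (n + i)) := by
  induction n generalizing x with
  | zero => simp [pre]
  | succ n ih =>
    rw [Nat.add_right_comm, pre, ih, pre, List.cons_append]
    simp [shift, Nat.add_right_comm]

theorem exists_red_app {l : List (L k)} {m : ℕ} {x : Boundary k} (h : pre m x.1 = l) :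
    ∃ y, Red k y ∧ x.1 = app l y := by
  obtain ⟨y, hy, hxy, -⟩ := exists_app_pre m x.2
  exact ⟨y, hy, h ▸ hxy⟩

theorem Cyl_eq {v : F k} {l : List (L k)} (h : v.toWord = l) :
    Cyl k v = {y | pre l.length y.1 = l} := by
  subst h
  ext x
  exact mem_Cyl_iff

theorem inv_mk_append_mul (X U V : List (L k)) :
    (FreeGroup.mk (X ++ U))⁻¹ * FreeGroup.mk (X ++ V) =
      FreeGroup.mk (FreeGroup.invRev U ++ V) := by
  rw [← FreeGroup.mul_mk, ← FreeGroup.mul_mk, ← FreeGroup.mul_mk, ← FreeGroup.inv_mk]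
  group

theorem toWord_inv_mk_append_mul {X U V : List (L k)} {s t : ℕ → L k}
    (hs : Red k (app U s)) (ht : Red k (app V t)) (hne : app V t 0 ≠ app U s 0) :
    ((FreeGroup.mk (X ++ U))⁻¹ * FreeGroup.mk (X ++ V)).toWord = FreeGroup.invRev U ++ V := by
  rw [inv_mk_append_mul]
  have := (red_app_invRev hs ht hne).1
  rw [← app_append] at this
  exact toWord_mk_of_red_app this

/-- A ray may be continued after the word `l` if it branches off from the way back. -/
theorem red_app_of_ne {l l' : List (L k)} {s s' t : ℕ → L k} (hl : l ≠ [])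
    (h : Red k (app (l' ++ l) s)) (hs' : Red k s')
    (hne : s' 0 ≠ app (FreeGroup.invRev l) t 0) : Red k (app (l' ++ l) s') := by
  obtain ⟨l₀, a, rfl⟩ := List.eq_nil_or_concat l |>.resolve_left hl
  have h0 : app (FreeGroup.invRev (l₀ ++ [a])) t 0 = linv k a := by
    simp [FreeGroup.invRev, app, cons, linv]
  rw [List.concat_eq_append, h0] at hne
  rw [List.concat_eq_append, ← List.append_assoc, app_append] at h ⊢
  exact red_app_congr h (red_cons k hs' hne) rfl

theorem Cyl2_mk_append {X U V : List (L k)} {s t : ℕ → L k} (hU : U ≠ []) (hV : V ≠ [])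
    (hs : Red k (app (X ++ U) s)) (ht : Red k (app (X ++ V) t))
    (hne : app V t 0 ≠ app U s 0) :
    Cyl2 k (FreeGroup.mk (X ++ U)) (FreeGroup.mk (X ++ V)) =
      {y | pre (X ++ U).length y.1 = X ++ U} ×ˢ {y | pre (X ++ V).length y.1 = X ++ V} := by
  have hUw : (FreeGroup.mk (X ++ U)).toWord = X ++ U := toWord_mk_of_red_app hs
  have hs' : Red k (app U s) := red_of_red_app (app_append X U s ▸ hs)
  have ht' : Red k (app V t) := red_of_red_app (app_append X V t ▸ ht)
  have hw := toWord_inv_mk_append_mul (X := X) hs' ht' hne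
  have head : ∀ (W : List (L k)), W ≠ [] → ∀ y z : ℕ → L k, app W y 0 = app W z 0 := by
    intro W hW y z
    cases W with
    | nil => exact absurd rfl hW
    | cons a W => rfl
  have hact : ∀ y : Boundary k, (act k (FreeGroup.mk (X ++ U)) y).1 =
      prependAux k (X ++ U).reverse y.1 := by
    intro y
    change prependAux k (FreeGroup.mk (X ++ U)).toWord.reverse y.1 = _
    rw [hUw]
  have hact2 : ∀ z : ℕ → L k, Red k (app X (app V z)) →
      prependAux k (X ++ U).reverse (app (FreeGroup.invRev U) (app V z)) =
        app (X ++ V) z := by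
    intro z hz
    rw [List.reverse_append, prependAux_append, prependAux_reverse_invRev,
      prependAux_reverse_of_red _ hz, app_append]
  have hX : ∀ z, Red k (app V z) → Red k (app X (app V z)) := fun z hz =>
    red_app_congr (app_append X V t ▸ ht) hz (head V hV t z)
  rw [Cyl2, baseCyl, Cyl_eq hw]
  ext ⟨p, q⟩
  constructor
  · rintro ⟨⟨a, b⟩, ⟨h0, hb⟩, hpq⟩
    obtain ⟨z, -, hbz⟩ := exists_red_app hb
    obtain ⟨rfl, rfl⟩ := Prod.mk.inj hpq
    simp only at h0
    rw [app_append] at hbz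
    have hz : Red k (app V z) := red_of_red_app (hbz ▸ b.2)
    rw [hbz] at h0
    have hp : (act k (FreeGroup.mk (X ++ U)) a).1 = app (X ++ U) a.1 := by
      rw [hact, prependAux_reverse_of_red _ (red_app_of_ne hU hs a.2 h0)]
    have hq : (act k (FreeGroup.mk (X ++ U)) b).1 = app (X ++ V) z := by
      rw [hact, hbz, hact2 z (hX z hz)]
    constructor
    · change pre _ (act k (FreeGroup.mk (X ++ U)) a).1 = _
      rw [hp, pre_app]
    · change pre _ (act k (FreeGroup.mk (X ++ U)) b).1 = _
      rw [hq, pre_app]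
  · rintro ⟨hp, hq⟩
    obtain ⟨y, hy, hpy⟩ := exists_red_app hp
    obtain ⟨z, -, hqz⟩ := exists_red_app hq
    simp only at hpy hqz
    have hyr : Red k (app U y) := red_of_red_app (app_append X U y ▸ hpy ▸ p.2)
    have hzr : Red k (app V z) := red_of_red_app (app_append X V z ▸ hqz ▸ q.2)
    obtain ⟨hr, hr0⟩ := red_app_invRev hyr hzr
      (by rw [head V hV z t, head U hU y s]; exact hne)
    refine ⟨(⟨y, hy⟩, ⟨_, hr⟩), ⟨hr0, ?_⟩, Prod.ext (Subtype.ext ?_) (Subtype.ext ?_)⟩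
    · change pre _ (app _ (app V z)) = _
      rw [← app_append, pre_app]
    · change (act k _ _).1 = _
      rw [hact, hpy, prependAux_reverse_of_red _ (hpy ▸ p.2)]
    · change (act k _ _).1 = _
      rw [hact, hqz, hact2 z (hX z hzr)]

/-- The pairs of rays which branch exactly after `n` letters. -/
def branchAt (k n : ℕ) : Set (Boundary k × Boundary k) :=
  {p | (∀ i < n, p.1.1 i = p.2.1 i) ∧ p.1.1 n ≠ p.2.1 n}

theorem isClopen_branchAt (n : ℕ) : IsClopen (branchAt k n) := by
  have : branchAt k n = (fun p : Boundary k × Boundary k => fun i : Fin (n + 1) =>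
      (p.1.1 i, p.2.1 i)) ⁻¹' {t | (∀ i : Fin n, (t i.castSucc).1 = (t i.castSucc).2) ∧
        (t (Fin.last n)).1 ≠ (t (Fin.last n)).2} := by
    ext p
    simp [branchAt, Fin.forall_iff]
  rw [this]
  exact (isClopen_discrete _).preimage (continuous_pi fun i =>
    ((continuous_letter _).comp continuous_fst).prodMk
      ((continuous_letter _).comp continuous_snd))

theorem iUnion_branchAt : ⋃ n, branchAt k n = D2 k := by
  ext p
  simp only [Set.mem_iUnion, D2, Set.mem_ofPred_eq]
  constructor
  · rintro ⟨n, hn⟩ h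
    exact hn.2 (by rw [h])
  · intro h
    have hex : ∃ n, p.1.1 n ≠ p.2.1 n := by
      by_contra! hc
      exact h (Subtype.ext (funext hc))
    classical
    exact ⟨Nat.find hex, fun i hi => not_not.1 (Nat.find_min hex hi), Nat.find_spec hex⟩

theorem pairwise_disjoint_branchAt : Pairwise (Function.onFun Disjoint (branchAt k)) := by
  intro m n hmn
  rw [Function.onFun, Set.disjoint_left]
  intro p hm hn
  rcases lt_or_gt_of_ne hmn with h | h
  · exact hm.2 (hn.1 m h)
  · exact hn.2 (hm.1 n h)

/-- The product of the cylinders of depth `m` around two rays. -/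
def box (m : ℕ) (p : Boundary k × Boundary k) : Set (Boundary k × Boundary k) :=
  {y | pre m y.1 = pre m p.1.1} ×ˢ {y | pre m y.1 = pre m p.2.1}

theorem box_subset_branchAt {m n : ℕ} (hmn : n < m) {p : Boundary k × Boundary k}
    (hp : p ∈ branchAt k n) : box m p ⊆ branchAt k n := by
  rintro q ⟨h1, h2⟩
  have h1' := pre_eq_iff.1 h1
  have h2' := pre_eq_iff.1 h2
  refine ⟨fun i hi => ?_, ?_⟩
  · rw [h1' i (by omega), h2' i (by omega)]
    exact hp.1 i hi
  · rw [h1' n hmn, h2' n hmn]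
    exact hp.2

theorem box_inter_branchAt_eq_empty {m n : ℕ} (hmn : n < m) {p : Boundary k × Boundary k}
    (hp : p ∉ branchAt k n) : box m p ∩ branchAt k n = ∅ := by
  refine Set.eq_empty_of_forall_notMem fun q ⟨⟨h1, h2⟩, hq⟩ => hp ?_
  exact box_subset_branchAt hmn hq ⟨h1.symm, h2.symm⟩

end Cylinders

/-! ### The uniform measure and the uniform current -/

section Uniform

variable {k}

theorem measure_pre {μ : Measure (Boundary k)}
    (hμ : ∀ v : F k, v ≠ 1 →
      μ (Cyl k v) = ((2 * k : ℝ≥0∞) * (2 * k - 1) ^ (wordLength k v - 1))⁻¹)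
    (m : ℕ) (x : Boundary k) :
    μ {y | pre (m + 1) y.1 = pre (m + 1) x.1} = ((2 * k : ℝ≥0∞) * (2 * k - 1) ^ m)⁻¹ := by
  obtain ⟨y, -, hxy, -⟩ := exists_app_pre (m + 1) x.2
  have hw : (FreeGroup.mk (pre (m + 1) x.1)).toWord = pre (m + 1) x.1 :=
    toWord_mk_of_red_app (x := y) (hxy ▸ x.2)
  have h := hμ (FreeGroup.mk (pre (m + 1) x.1)) (by
    rw [Ne, ← FreeGroup.toWord_eq_nil_iff, hw]
    simp [pre])
  rwa [Cyl_eq hw, wordLength, hw, length_pre, Nat.add_sub_cancel] at h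

theorem current_box {μ : Measure (Boundary k)}
    (hμ : ∀ v : F k, v ≠ 1 →
      μ (Cyl k v) = ((2 * k : ℝ≥0∞) * (2 * k - 1) ^ (wordLength k v - 1))⁻¹)
    {η : Measure (Boundary k × Boundary k)}
    (hη : ∀ x y : F k, η (Cyl2 k x y) = μ (Cyl k (x⁻¹ * y)))
    (n j : ℕ) {p : Boundary k × Boundary k} (hp : p ∈ branchAt k n) :
    η (box (n + (j + 1)) p) = ((2 * k : ℝ≥0∞) * (2 * k - 1) ^ (2 * j + 1))⁻¹ := by
  obtain ⟨s, -, hs, -⟩ := exists_app_pre (n + (j + 1)) p.1.2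
  obtain ⟨t, -, ht, -⟩ := exists_app_pre (n + (j + 1)) p.2.2
  have hX : pre n p.1.1 = pre n p.2.1 := pre_eq_iff.2 hp.1
  set U := pre (j + 1) (fun i => p.1.1 (n + i)) with hU
  set V := pre (j + 1) (fun i => p.2.1 (n + i)) with hV
  set X := pre n p.2.1
  have hXU : pre (n + (j + 1)) p.1.1 = X ++ U := by rw [pre_add, hX]
  have hXV : pre (n + (j + 1)) p.2.1 = X ++ V := pre_add _ _ _
  have hs' : Red k (app (X ++ U) s) := hXU ▸ hs ▸ p.1.2
  have ht' : Red k (app (X ++ V) t) := hXV ▸ ht ▸ p.2.2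
  have hne : app V t 0 ≠ app U s 0 := hp.2.symm
  have hU' : U ≠ [] := List.cons_ne_nil _ _
  have hV' : V ≠ [] := List.cons_ne_nil _ _
  have hbox : box (n + (j + 1)) p = Cyl2 k (FreeGroup.mk (X ++ U)) (FreeGroup.mk (X ++ V)) := by
    rw [Cyl2_mk_append hU' hV' hs' ht' hne, box, hXU, hXV, ← hXU, ← hXV, length_pre,
      length_pre]
  have hw := toWord_inv_mk_append_mul (X := X) (red_of_red_app (app_append X U s ▸ hs'))
    (red_of_red_app (app_append X V t ▸ ht')) hne
  have hlen : wordLength k ((FreeGroup.mk (X ++ U))⁻¹ * FreeGroup.mk (X ++ V)) =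
      2 * j + 2 := by
    rw [wordLength, hw, List.length_append, FreeGroup.invRev_length, hU, hV, length_pre,
      length_pre]
    omega
  rw [hbox, hη, hμ, hlen]
  · rfl
  · rw [Ne, ← FreeGroup.toWord_eq_nil_iff, hw]
    simp [hV']

theorem one_le_two_mul_sub_one (hk : 2 ≤ k) : (1 : ℝ≥0∞) ≤ 2 * k - 1 := by
  refine ENNReal.le_sub_of_add_le_right (by simp) ?_
  exact_mod_cast (by omega : 1 + 1 ≤ 2 * k)

theorem two_mul_sub_one_ne_top : (2 * k - 1 : ℝ≥0∞) ≠ ⊤ :=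
  ENNReal.sub_ne_top (ENNReal.mul_ne_top (by simp) (by simp))

theorem isFiniteMeasure_restrict_branchAt {η : Measure (Boundary k × Boundary k)}
    (hη : IsCurrent k η) (n : ℕ) : IsFiniteMeasure (η.restrict (branchAt k n)) := by
  refine ⟨?_⟩
  rw [Measure.restrict_apply_univ]
  exact hη.2.2 _ (iUnion_branchAt (k := k) ▸ Set.subset_iUnion _ n)
    (isClopen_branchAt n).isClosed.isCompact

variable {μ : Measure (Boundary k)} [IsProbabilityMeasure μ]
  {η : Measure (Boundary k × Boundary k)}

theorem prod_restrict_le_current (hk : 2 ≤ k)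
    (hμ : ∀ v : F k, v ≠ 1 →
      μ (Cyl k v) = ((2 * k : ℝ≥0∞) * (2 * k - 1) ^ (wordLength k v - 1))⁻¹)
    (hη : IsCurrent k η) (hη' : ∀ x y : F k, η (Cyl2 k x y) = μ (Cyl k (x⁻¹ * y))) (n : ℕ) :
    (μ.prod μ).restrict (branchAt k n) ≤ η.restrict (branchAt k n) := by
  have := isFiniteMeasure_restrict_branchAt hη n
  refine measure_le_of_pre_prod (n + 1) _ _ fun m p hm => ?_
  obtain ⟨j, rfl⟩ : ∃ j, m = n + (j + 1) := ⟨m - n - 1, by omega⟩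
  change (μ.prod μ).restrict (branchAt k n) (box _ p) ≤ η.restrict (branchAt k n) (box _ p)
  have hD := (isClopen_branchAt (k := k) n).isOpen.measurableSet
  rw [Measure.restrict_apply' hD, Measure.restrict_apply' hD]
  by_cases hp : p ∈ branchAt k n
  · rw [Set.inter_eq_left.2 (box_subset_branchAt (by omega) hp), current_box hμ hη' n j hp,
      box, Measure.prod_prod, ← Nat.add_assoc, measure_pre hμ, measure_pre hμ]
    have hq := one_le_two_mul_sub_one hk
    have hqN : (2 * k - 1 : ℝ≥0∞) ≤ 2 * k := tsub_le_self
    set q : ℝ≥0∞ := 2 * k - 1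
    set N : ℝ≥0∞ := 2 * k
    have hN : N ≠ 0 := (zero_lt_one.trans_le (hq.trans hqN)).ne'
    have hq0 : q ≠ 0 := (zero_lt_one.trans_le hq).ne'
    rw [← ENNReal.mul_inv (Or.inl (mul_ne_zero hN (pow_ne_zero _ hq0)))
      (Or.inr (mul_ne_zero hN (pow_ne_zero _ hq0))), ENNReal.inv_le_inv]
    calc N * q ^ (2 * j + 1) = N * (1 * q ^ (2 * j)) * q := by ring
      _ ≤ N * (q ^ (2 * n) * q ^ (2 * j)) * N := by
        gcongr
        exact one_le_pow₀ hq
      _ = N * q ^ (n + j) * (N * q ^ (n + j)) := by ring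
  · rw [box_inter_branchAt_eq_empty (by omega) hp]
    simp

theorem current_restrict_le_prod (hk : 2 ≤ k)
    (hμ : ∀ v : F k, v ≠ 1 →
      μ (Cyl k v) = ((2 * k : ℝ≥0∞) * (2 * k - 1) ^ (wordLength k v - 1))⁻¹)
    (hη' : ∀ x y : F k, η (Cyl2 k x y) = μ (Cyl k (x⁻¹ * y))) (n : ℕ) :
    ((2 * k : ℝ≥0∞) * (2 * k - 1) ^ (2 * n))⁻¹ • η.restrict (branchAt k n) ≤ μ.prod μ := by
  refine measure_le_of_pre_prod (n + 1) _ _ fun m p hm => ?_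
  obtain ⟨j, rfl⟩ : ∃ j, m = n + (j + 1) := ⟨m - n - 1, by omega⟩
  change (_ • η.restrict (branchAt k n)) (box _ p) ≤ μ.prod μ (box _ p)
  have hD := (isClopen_branchAt (k := k) n).isOpen.measurableSet
  rw [Measure.smul_apply, smul_eq_mul, Measure.restrict_apply' hD]
  by_cases hp : p ∈ branchAt k n
  · rw [Set.inter_eq_left.2 (box_subset_branchAt (by omega) hp), current_box hμ hη' n j hp,
      box, Measure.prod_prod, ← Nat.add_assoc, measure_pre hμ, measure_pre hμ]
    have hq := one_le_two_mul_sub_one hk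
    have hqN : (2 * k - 1 : ℝ≥0∞) ≤ 2 * k := tsub_le_self
    set q : ℝ≥0∞ := 2 * k - 1
    set N : ℝ≥0∞ := 2 * k
    have hN : N ≠ 0 := (zero_lt_one.trans_le (hq.trans hqN)).ne'
    have hq0 : q ≠ 0 := (zero_lt_one.trans_le hq).ne'
    have hne : ∀ i, N * q ^ i ≠ 0 := fun i => mul_ne_zero hN (pow_ne_zero _ hq0)
    rw [← ENNReal.mul_inv (Or.inl (hne _)) (Or.inr (hne _)),
      ← ENNReal.mul_inv (Or.inl (hne _)) (Or.inr (hne _)), ENNReal.inv_le_inv]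
    calc N * q ^ (n + j) * (N * q ^ (n + j))
        = N * q ^ (2 * n) * (N * (q ^ (2 * j) * 1)) := by ring
      _ ≤ N * q ^ (2 * n) * (N * (q ^ (2 * j) * q)) := by gcongr
      _ = N * q ^ (2 * n) * (N * q ^ (2 * j + 1)) := by ring
  · rw [box_inter_branchAt_eq_empty (by omega) hp]
    simp

theorem measure_inter_D2 (ν : Measure (Boundary k × Boundary k))
    {W : Set (Boundary k × Boundary k)} (hW : MeasurableSet W) :
    ν (W ∩ D2 k) = ∑' n, ν.restrict (branchAt k n) W := by
  have hD := fun n => (isClopen_branchAt (k := k) n).isOpen.measurableSet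
  rw [← iUnion_branchAt, Set.inter_iUnion, measure_iUnion]
  · exact tsum_congr fun n => (Measure.restrict_apply' (hD n)).symm
  · exact fun m n hmn => (pairwise_disjoint_branchAt hmn).mono Set.inter_subset_right
      Set.inter_subset_right
  · exact fun n => hW.inter (hD n)

/-- Left translation by `g` distorts the uniform measure by at most `(2k - 1) ^ |g|`. -/
theorem smul_measure_le_map_act (hk : 2 ≤ k)
    (hμ : ∀ v : F k, v ≠ 1 →
      μ (Cyl k v) = ((2 * k : ℝ≥0∞) * (2 * k - 1) ^ (wordLength k v - 1))⁻¹) (g : F k) :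
    ((2 * k - 1 : ℝ≥0∞) ^ wordLength k g)⁻¹ • μ ≤ μ.map (act k g) := by
  have := Measure.isFiniteMeasure_map μ (act k g)
  refine measure_le_of_pre _ _ fun m x hm => ?_
  obtain ⟨m, rfl⟩ := Nat.exists_eq_add_of_le' hm
  obtain ⟨x', hx', m', hm', hle, H⟩ := exists_cylinder_prependAux g.toWord.reverse hm x.2
  obtain ⟨m', rfl⟩ := Nat.exists_eq_add_of_le' hm'
  have hsub : {y : Boundary k | pre (m' + 1) y.1 = pre (m' + 1) x'} ⊆
      act k g ⁻¹' {y | pre (m + 1) y.1 = pre (m + 1) x.1} := fun y hy =>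
    pre_eq_iff.2 (H y.1 y.2 (pre_eq_iff.1 hy))
  rw [Measure.map_apply (continuous_act g).measurable
    (isClopen_pre _ _).isOpen.measurableSet]
  refine le_trans ?_ (measure_mono hsub)
  rw [Measure.smul_apply, smul_eq_mul, measure_pre hμ m x, measure_pre hμ m' ⟨x', hx'⟩]
  have hq := one_le_two_mul_sub_one hk
  have hqt : (2 * k - 1 : ℝ≥0∞) ≠ ⊤ := two_mul_sub_one_ne_top
  have hlen : m' ≤ wordLength k g + m := by
    rw [List.length_reverse] at hle
    rw [wordLength]
    omega
  set q : ℝ≥0∞ := 2 * k - 1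
  have hq0 : q ≠ 0 := (zero_lt_one.trans_le hq).ne'
  rw [← ENNReal.mul_inv (Or.inl (pow_ne_zero _ hq0)) (Or.inl (ENNReal.pow_ne_top hqt)),
    ENNReal.inv_le_inv]
  calc (2 * k : ℝ≥0∞) * q ^ m' ≤ 2 * k * q ^ (wordLength k g + m) := by gcongr
    _ = q ^ wordLength k g * (2 * k * q ^ m) := by ring

/-- If the image of `Eᶜ` under `g` lies in `S`, then `E` cannot be much smaller than `Sᶜ`. -/
theorem mul_one_sub_le_measure (hk : 2 ≤ k)
    (hμ : ∀ v : F k, v ≠ 1 →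
      μ (Cyl k v) = ((2 * k : ℝ≥0∞) * (2 * k - 1) ^ (wordLength k v - 1))⁻¹) (g : F k)
    {E S : Set (Boundary k)} (hS : MeasurableSet S) (h : act k g '' Eᶜ ⊆ S) :
    ((2 * k - 1 : ℝ≥0∞) ^ wordLength k g)⁻¹ * (1 - μ S) ≤ μ E := by
  have hsub : act k g ⁻¹' Sᶜ ⊆ E := fun x hx => by
    by_contra hxE
    exact hx (h ⟨x, hxE, rfl⟩)
  rw [← prob_compl_eq_one_sub hS]
  calc _ = (((2 * k - 1 : ℝ≥0∞) ^ wordLength k g)⁻¹ • μ) Sᶜ := rfl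
    _ ≤ μ.map (act k g) Sᶜ := smul_measure_le_map_act hk hμ g _
    _ = μ (act k g ⁻¹' Sᶜ) := Measure.map_apply (continuous_act g).measurable hS.compl
    _ ≤ μ E := measure_mono hsub

end Uniform

theorem key_estimate (k : ℕ) (hk : 2 ≤ k)
    (μA : Measure (Boundary k)) [IsProbabilityMeasure μA]
    (hμA : ∀ v : F k, v ≠ 1 →
      μA (Cyl k v) = ((2 * k : ℝ≥0∞) * (2 * k - 1) ^ (wordLength k v - 1))⁻¹)
    (ηA : Measure (Boundary k × Boundary k)) (hηA : IsCurrent k ηA)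
    (hηA' : ∀ x y : F k, ηA (Cyl2 k x y) = μA (Cyl k (x⁻¹ * y)))
    (f : F k) (E S : Set (Boundary k))
    (hE : MeasurableSet E) (hS : MeasurableSet S) (hES : Disjoint E S)
    (h1 : act k f '' Eᶜ ⊆ S) (h2 : act k f⁻¹ '' Sᶜ ⊆ E) :
    ((2 * k - 1 : ℝ≥0∞) ^ (2 * wordLength k f))⁻¹ * (1 - μA E) * (1 - μA S)
        ≤ ηA ((E ×ˢ S) ∩ D2 k) ∧
      (ηA ((E ×ˢ S) ∩ D2 k) = 0 ↔ μA E = 1 ∨ μA S = 1) := by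
  have hW : MeasurableSet (E ×ˢ S) := hE.prod hS
  have hsubD : E ×ˢ S ⊆ D2 k := fun p hp h =>
    Set.disjoint_left.1 hES hp.1 (by rw [show p.1 = p.2 from h]; exact hp.2)
  have hlower : μA E * μA S ≤ ηA ((E ×ˢ S) ∩ D2 k) := by
    rw [← Measure.prod_prod, ← Set.inter_eq_left.2 hsubD, Set.inter_assoc, Set.inter_self,
      measure_inter_D2 _ hW, measure_inter_D2 _ hW]
    exact ENNReal.tsum_le_tsum fun n => prod_restrict_le_current hk hμA hηA hηA' n _
  have hqt : (2 * k - 1 : ℝ≥0∞) ≠ ⊤ := two_mul_sub_one_ne_top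
  have hnull : μA E * μA S = 0 → ηA ((E ×ˢ S) ∩ D2 k) = 0 := by
    intro h0
    rw [measure_inter_D2 _ hW, ENNReal.tsum_eq_zero]
    intro n
    have h := current_restrict_le_prod hk hμA hηA' n (E ×ˢ S)
    rw [Measure.prod_prod, h0, Measure.smul_apply, smul_eq_mul] at h
    refine (mul_eq_zero.1 (le_antisymm h zero_le)).resolve_left (ENNReal.inv_ne_zero.2 ?_)
    exact ENNReal.mul_ne_top (ENNReal.mul_ne_top (by simp) (by simp)) (ENNReal.pow_ne_top hqt)
  have hbound : ((2 * k - 1 : ℝ≥0∞) ^ (2 * wordLength k f))⁻¹ * (1 - μA E) * (1 - μA S)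
      ≤ ηA ((E ×ˢ S) ∩ D2 k) := by
    have hEle := mul_one_sub_le_measure hk hμA f hS h1
    have hSle := mul_one_sub_le_measure hk hμA f⁻¹ hE h2
    have hlen : wordLength k f⁻¹ = wordLength k f := by
      rw [wordLength, FreeGroup.toWord_inv, FreeGroup.invRev_length, wordLength]
    rw [hlen] at hSle
    refine le_trans (le_of_eq ?_) ((mul_le_mul' hEle hSle).trans hlower)
    rw [two_mul (wordLength k f), pow_add, ENNReal.mul_inv (Or.inr (ENNReal.pow_ne_top hqt))
      (Or.inl (ENNReal.pow_ne_top hqt))]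
    ring
  refine ⟨hbound, fun h => ?_, fun h => hnull ?_⟩
  · rw [h] at hbound
    rcases mul_eq_zero.1 (le_antisymm hbound zero_le) with h' | h'
    · refine Or.inl (le_antisymm prob_le_one (tsub_eq_zero_iff_le.1 ?_))
      exact (mul_eq_zero.1 h').resolve_left (ENNReal.inv_ne_zero.2 (ENNReal.pow_ne_top hqt))
    · exact Or.inr (le_antisymm prob_le_one (tsub_eq_zero_iff_le.1 h'))
  · rcases h with h | h
    · have : μA S ≤ 0 := by
        rw [← (prob_compl_eq_zero_iff hE).2 h]
        exact measure_mono (Set.disjoint_left.1 hES.symm)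
      rw [le_antisymm this zero_le, mul_zero]
    · have : μA E ≤ 0 := by
        rw [← (prob_compl_eq_zero_iff hS).2 h]
        exact measure_mono (Set.disjoint_left.1 hES)
      rw [le_antisymm this zero_le, zero_mul]

end

end FGC
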